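/- Let A be the unital ℂ-algebra of 2×2 matrices (a b; c d) over 𝕄 = ℂ[t,t⁻¹] with a, d balanced and b, c anti-balanced. Then the subset I = {(a b; c d) ∈ A : d(1) = 0 and d(−1) = 0} is a two-sided ideal of A. -/

import Mathlib

open LaurentPolynomial

/-- The set `A` of `2×2` matrices over `𝕄 = ℂ[t,t⁻¹]` whose diagonal
entries are balanced and whose off-diagonal entries are anti-balanced
(with respect to the involution `α = LaurentPolynomial.invert`, `t ↦ t⁻¹`);
it is a unital `ℂ`-subalgebra of `M₂(𝕄)`. -/
def ASet : Set (Matrix (Fin 2) (Fin 2) (LaurentPolynomial ℂ)) :=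
  {M | invert (M 0 0) = M 0 0 ∧ invert (M 1 1) = M 1 1 ∧
    invert (M 0 1) = -(M 0 1) ∧ invert (M 1 0) = -(M 1 0)}

/-- An algebra homomorphism taking the same value on `T n` and `T (-n)` is invariant under
`invert`. -/
theorem map_invert_of_map_T_neg (ev : LaurentPolynomial ℂ →ₐ[ℂ] ℂ)
    (h : ∀ n : ℤ, ev (T (-n)) = ev (T n)) (p : LaurentPolynomial ℂ) :
    ev (invert p) = ev p := by
  induction p using LaurentPolynomial.induction_on' with
  | add p q hp hq => simp only [map_add, hp, hq]
  | C_mul_T n a => simp only [map_mul, invert_C, invert_T, h]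

/-- An algebra homomorphism taking the same value on `T n` and `T (-n)` kills anti-balanced
Laurent polynomials. -/
theorem map_eq_zero_of_invert_eq_neg (ev : LaurentPolynomial ℂ →ₐ[ℂ] ℂ)
    (h : ∀ n : ℤ, ev (T (-n)) = ev (T n)) {p : LaurentPolynomial ℂ}
    (hp : invert p = -p) : ev p = 0 := by
  have h₁ := map_invert_of_map_T_neg ev h p
  rw [hp, map_neg] at h₁
  exact neg_eq_self.mp h₁

theorem mul_mem_ASet {m x : Matrix (Fin 2) (Fin 2) (LaurentPolynomial ℂ)}
    (hm : m ∈ ASet) (hx : x ∈ ASet) : m * x ∈ ASet := by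
  obtain ⟨ha, hd, hb, hc⟩ := hm
  obtain ⟨ha', hd', hb', hc'⟩ := hx
  refine ⟨?_, ?_, ?_, ?_⟩ <;>
    simp only [Matrix.mul_apply, Fin.sum_univ_two, map_add, map_mul,
      ha, hb, hc, hd, ha', hb', hc', hd'] <;> ring

/-- Taking the lower right entry and then evaluating is multiplicative when the left factor
lies in `ASet`. -/
theorem map_mul_apply_one_one (ev : LaurentPolynomial ℂ →ₐ[ℂ] ℂ)
    (h : ∀ n : ℤ, ev (T (-n)) = ev (T n))
    {m x : Matrix (Fin 2) (Fin 2) (LaurentPolynomial ℂ)} (hm : m ∈ ASet) :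
    ev ((m * x) 1 1) = ev (m 1 1) * ev (x 1 1) := by
  rw [Matrix.mul_apply, Fin.sum_univ_two, map_add, map_mul, map_mul,
    map_eq_zero_of_invert_eq_neg ev h hm.2.2.2, zero_mul, zero_add]

/-- Inside the unital `ℂ`-algebra `A` of `2×2` matrices
`(a b; c d)` over `𝕄 = ℂ[t,t⁻¹]` with `a, d` balanced and `b, c`
anti-balanced, the subset `I = {(a b; c d) ∈ A : d(1) = 0 and d(−1) = 0}` is
a two-sided ideal of `A`: it contains `0`, is closed under addition and
negation, and absorbs multiplication on both sides by elements of `A`.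
(The evaluation maps at `1` and `−1` are specified as the `ℂ`-algebra
homomorphisms `ev1`, `evneg1` with `ev1 (tⁿ) = 1`, `evneg1 (tⁿ) = (−1)ⁿ`.) -/
theorem stmt7 (ev1 evneg1 : LaurentPolynomial ℂ →ₐ[ℂ] ℂ)
    (hev1 : ∀ n : ℤ, ev1 (T n) = 1)
    (hevneg1 : ∀ n : ℤ, evneg1 (T n) = (-1 : ℂ) ^ n) :
    ∀ I : Set (Matrix (Fin 2) (Fin 2) (LaurentPolynomial ℂ)),
      I = {M ∈ ASet | ev1 (M 1 1) = 0 ∧ evneg1 (M 1 1) = 0} →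
      (I ⊆ ASet) ∧ (0 ∈ I) ∧
      (∀ x ∈ I, ∀ y ∈ I, x + y ∈ I) ∧
      (∀ x ∈ I, -x ∈ I) ∧
      (∀ m ∈ ASet, ∀ x ∈ I, m * x ∈ I ∧ x * m ∈ I) := by
  have h1 : ∀ n : ℤ, ev1 (T (-n)) = ev1 (T n) := fun n => by rw [hev1, hev1]
  have h2 : ∀ n : ℤ, evneg1 (T (-n)) = evneg1 (T n) := fun n => by
    rw [hevneg1, hevneg1, zpow_neg, ← inv_zpow, inv_neg_one]
  rintro I rfl
  refine ⟨fun x hx => hx.1, ?_, ?_, ?_, ?_⟩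
  · simp [ASet]
  · rintro x ⟨⟨ha, hd, hb, hc⟩, hx1, hx2⟩ y ⟨⟨ha', hd', hb', hc'⟩, hy1, hy2⟩
    refine ⟨⟨?_, ?_, ?_, ?_⟩, ?_, ?_⟩ <;>
      simp only [Matrix.add_apply, map_add, ha, hb, hc, hd, ha', hb', hc', hd',
        hx1, hx2, hy1, hy2, neg_add, add_zero]
  · rintro x ⟨⟨ha, hd, hb, hc⟩, hx1, hx2⟩
    refine ⟨⟨?_, ?_, ?_, ?_⟩, ?_, ?_⟩ <;>
      simp only [Matrix.neg_apply, map_neg, ha, hb, hc, hd, hx1, hx2, neg_zero]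
  · rintro m hm x ⟨hx, hx1, hx2⟩
    refine ⟨⟨mul_mem_ASet hm hx, ?_, ?_⟩, ⟨mul_mem_ASet hx hm, ?_, ?_⟩⟩
    · rw [map_mul_apply_one_one ev1 h1 hm, hx1, mul_zero]
    · rw [map_mul_apply_one_one evneg1 h2 hm, hx2, mul_zero]
    · rw [map_mul_apply_one_one ev1 h1 hx, hx1, zero_mul]
    · rw [map_mul_apply_one_one evneg1 h2 hx, hx2, zero_mul]
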